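/- arXiv:2102.00597 — 4 statements merged into one kernel-verified Lean document; each statement's English description precedes it below -/
import Mathlib

section
/- Let C be a nontrivial near MDS (NMDS) code of length n and dimension k over GF(q), so that d(C) = n − k and d(C⊥) = k. If C⊥ contains no codeword of Hamming weight k + 1, then C has minimum linear locality k − 1 (= d(C⊥) − 1). -/
open scoped BigOperators

variable {F : Type*} [Field F] {ι : Type*} [Fintype ι]

/-- The Hamming weight of a word: the number of nonzero coordinates. -/
noncomputable def wt (c : ι → F) : ℕ := {i | c i ≠ 0}.ncard

/-- The minimum distance of a linear code: the least Hamming weight of a nonzero codeword. -/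
noncomputable def minDist (C : Submodule F (ι → F)) : ℕ :=
  sInf {w | ∃ c ∈ C, c ≠ 0 ∧ wt c = w}

/-- The dual code of a linear code. -/
def dualCode (C : Submodule F (ι → F)) : Submodule F (ι → F) where
  carrier := {x | ∀ c ∈ C, ∑ i, x i * c i = 0}
  add_mem' := by
    intro a b ha hb c hc
    have h1 := ha c hc
    have h2 := hb c hc
    simp only [Set.mem_setOf_eq, Pi.add_apply, add_mul, Finset.sum_add_distrib, h1, h2, add_zero]
  zero_mem' := by intro c hc; simp
  smul_mem' := by
    intro r a ha c hc
    have h := ha c hc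
    simp only [Set.mem_setOf_eq, Pi.smul_apply, smul_eq_mul, mul_assoc, ← Finset.mul_sum, h,
      mul_zero]

/-- `C` has linear locality `r`: every code symbol `c i` is a fixed linear combination of
at most `r` other code symbols. -/
def HasLinearLocality (C : Submodule F (ι → F)) (r : ℕ) : Prop :=
  ∀ i : ι, ∃ (R : Finset ι) (u : ι → F), i ∉ R ∧ R.card ≤ r ∧
    ∀ c ∈ C, c i = ∑ j ∈ R, u j * c j

theorem wt_eq_card_of_forall_iff {κ : Type*} {c : κ → F} {S : Finset κ} (h : ∀ i, c i ≠ 0 ↔ i ∈ S) :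
    wt c = S.card := by
  have hs : {i | c i ≠ 0} = (S : Set κ) := by
    ext i
    simpa using h i
  rw [wt, hs, Set.ncard_coe_finset]

theorem wt_le_card_of_support_subset {κ : Type*} {c : κ → F} {S : Finset κ}
    (h : ∀ i, c i ≠ 0 → i ∈ S) : wt c ≤ S.card := by
  rw [wt, ← Set.ncard_coe_finset]
  exact Set.ncard_le_ncard h S.finite_toSet

theorem minDist_le_wt {κ : Type*} {C : Submodule F (κ → F)} {c : κ → F} (hc : c ∈ C)
    (h0 : c ≠ 0) : minDist C ≤ wt c :=
  Nat.sInf_le ⟨c, hc, h0, rfl⟩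

/-- A code of dimension greater than `S.card` has a nonzero codeword vanishing on `S`. -/
theorem exists_ne_zero_mem_vanishing_on (C : Submodule F (ι → F)) (S : Finset ι)
    (h : S.card < Module.finrank F C) : ∃ c ∈ C, c ≠ 0 ∧ ∀ i ∈ S, c i = 0 := by
  let f : C →ₗ[F] (S → F) := (LinearMap.funLeft F F (Subtype.val : S → ι)).comp C.subtype
  have hf : LinearMap.ker f ≠ ⊥ := LinearMap.ker_ne_bot_of_finrank_lt (by simpa using h)
  obtain ⟨c, hc, hc0⟩ := Submodule.exists_mem_ne_zero_of_ne_bot hf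
  refine ⟨c, c.2, by simpa using hc0, fun i hi => ?_⟩
  exact congrFun (LinearMap.mem_ker.mp hc) ⟨i, hi⟩

/-- If `S` has more elements than the dimension of `C`, then `S` contains the support of a
nonzero dual codeword. -/
theorem exists_ne_zero_mem_dualCode_supported_on (C : Submodule F (ι → F)) (S : Finset ι)
    (h : Module.finrank F C < S.card) :
    ∃ x ∈ dualCode C, x ≠ 0 ∧ ∀ i, x i ≠ 0 → i ∈ S := by
  classical
  let ev : S → Module.Dual F C := fun i => (LinearMap.proj (i : ι)).comp C.subtype
  have hdep : ¬ LinearIndependent F ev := fun hli => by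
    have := hli.fintype_card_le_finrank
    rw [Subspace.dual_finrank_eq, Fintype.card_coe] at this
    omega
  obtain ⟨g, hg, j, hj⟩ := Fintype.not_linearIndependent_iff.mp hdep
  refine ⟨fun i => if hi : i ∈ S then g ⟨i, hi⟩ else 0, fun c hc => ?_, fun h0 => ?_,
    fun i hi => ?_⟩
  · have h1 := LinearMap.congr_fun hg ⟨c, hc⟩
    simp only [LinearMap.sum_apply, LinearMap.smul_apply, smul_eq_mul, LinearMap.zero_apply] at h1
    rw [← Finset.sum_subset (Finset.subset_univ S), ← Finset.sum_coe_sort S]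
    · refine Eq.trans ?_ h1
      exact Finset.sum_congr rfl fun i _ => by simp [ev]
    · intro i _ hi
      simp [hi]
  · exact hj (by simpa using congrFun h0 (j : ι))
  · by_contra hiS
    simp [hiS] at hi

/-- A linear recovery relation of locality `r` yields a dual codeword of weight at most `r + 1`. -/
theorem HasLinearLocality.minDist_dualCode_le [Nonempty ι] {C : Submodule F (ι → F)} {r : ℕ}
    (h : HasLinearLocality C r) : minDist (dualCode C) ≤ r + 1 := by
  classical
  obtain ⟨i⟩ := ‹Nonempty ι›
  obtain ⟨R, u, hi, hR, hu⟩ := h i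
  let x : ι → F := fun j => if j = i then -1 else if j ∈ R then u j else 0
  have hx : x ∈ dualCode C := fun c hc => by
    have hsub : ∑ j, x j * c j = ∑ j ∈ insert i R, x j * c j := by
      refine (Finset.sum_subset (Finset.subset_univ _) fun j _ hj => ?_).symm
      simp only [Finset.mem_insert, not_or] at hj
      simp [x, hj.1, hj.2]
    have hR : ∑ j ∈ R, x j * c j = ∑ j ∈ R, u j * c j :=
      Finset.sum_congr rfl fun j hj => by
        have : j ≠ i := fun h => hi (h ▸ hj)
        simp [x, this, hj]
    rw [hsub, Finset.sum_insert hi, hR, ← hu c hc]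
    simp [x]
  have hx0 : x ≠ 0 := fun h0 => by simpa [x] using congrFun h0 i
  have hwt : wt x ≤ (insert i R).card := wt_le_card_of_support_subset fun j hj => by
    by_contra hjR
    simp only [Finset.mem_insert, not_or] at hjR
    simp [x, hjR.1, hjR.2] at hj
  have := minDist_le_wt hx hx0
  rw [Finset.card_insert_of_notMem hi] at hwt
  omega

/-- If every coordinate lies in the support of a dual codeword of weight at most `k`, then the
code has linear locality `k - 1`. -/
theorem hasLinearLocality_of_dualCode {C : Submodule F (ι → F)} {k : ℕ}
    (h : ∀ i, ∃ x ∈ dualCode C, x i ≠ 0 ∧ wt x ≤ k) : HasLinearLocality C (k - 1) := by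
  classical
  intro i
  obtain ⟨x, hx, hi, hwt⟩ := h i
  let S : Finset ι := Finset.univ.filter fun j => x j ≠ 0
  have hiS : i ∈ S := by simp [S, hi]
  have hS : wt x = S.card := wt_eq_card_of_forall_iff fun j => by simp [S]
  refine ⟨S.erase i, fun j => -(x i)⁻¹ * x j, Finset.notMem_erase i S, ?_, fun c hc => ?_⟩
  · rw [Finset.card_erase_of_mem hiS]
    omega
  · have h0 : ∑ j ∈ S, x j * c j = 0 := by
      rw [← hx c hc]
      refine Finset.sum_subset (Finset.subset_univ S) fun j _ hj => ?_
      have : x j = 0 := by simpa [S] using hj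
      simp [this]
    rw [← Finset.add_sum_erase S _ hiS] at h0
    simp only [mul_assoc, ← Finset.mul_sum]
    rw [eq_neg_of_add_eq_zero_right h0]
    field_simp

/-- A set `S` such that only the zero codeword of `C` vanishes on it cannot contain two sets
`S.erase a` and `S.erase b`, with `a ≠ b`, which both are supports of dual codewords, when
`S.card ≤ dim C + 1`. -/
theorem eq_of_dualCode_support_eq_erase [DecidableEq ι] {C : Submodule F (ι → F)} {S : Finset ι}
    (hS : S.card ≤ Module.finrank F C + 1) (hinj : ∀ c ∈ C, (∀ i ∈ S, c i = 0) → c = 0)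
    {a b : ι} (ha : a ∈ S) (hb : b ∈ S) {x y : ι → F} (hx : x ∈ dualCode C) (hy : y ∈ dualCode C)
    (hxS : ∀ i, x i ≠ 0 ↔ i ∈ S.erase a) (hyS : ∀ i, y i ≠ 0 ↔ i ∈ S.erase b) : a = b := by
  by_contra hab
  have hb' : b ∈ S.erase a := Finset.mem_erase.mpr ⟨Ne.symm hab, hb⟩
  have ha' : a ∈ S.erase b := Finset.mem_erase.mpr ⟨hab, ha⟩
  have hcard : ((S.erase a).erase b).card < Module.finrank F C := by
    have h1 := Finset.card_erase_add_one hb'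
    have h2 := Finset.card_erase_add_one ha
    omega
  obtain ⟨c, hc, hc0, hcS⟩ := exists_ne_zero_mem_vanishing_on C _ hcard
  have hcb : c b = 0 := by
    have h := hx c hc
    rw [Finset.sum_eq_single b] at h
    · exact (mul_eq_zero.mp h).resolve_left ((hxS b).mpr hb')
    · intro j _ hj
      by_cases hxj : x j = 0
      · simp [hxj]
      · rw [hcS j (Finset.mem_erase.mpr ⟨hj, (hxS j).mp hxj⟩), mul_zero]
    · simp
  have hca : c a = 0 := by
    have h := hy c hc
    rw [Finset.sum_eq_single a] at h
    · exact (mul_eq_zero.mp h).resolve_left ((hyS a).mpr ha')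
    · intro j _ hj
      by_cases hyj : y j = 0
      · simp [hyj]
      · have hj' := Finset.mem_erase.mp ((hyS j).mp hyj)
        rw [hcS j (by simp [hj, hj'.1, hj'.2]), mul_zero]
    · simp
  refine hc0 (hinj c hc fun i hi => ?_)
  by_cases hia : i = a
  · rwa [hia]
  by_cases hib : i = b
  · rwa [hib]
  exact hcS i (by simp [hia, hib, hi])

/-- Let `C` be a nontrivial NMDS code of length `n` and dimension `k`. If
`C⊥` contains no codeword of weight `k + 1`, then `C` has minimum linear locality
`k - 1 = d(C⊥) - 1`. -/
theorem statement15 (C : Submodule F (ι → F)) (n k : ℕ)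
    (hn : Fintype.card ι = n) (hk : Module.finrank F C = k)
    (hk2 : 2 ≤ k) (hnk2 : 2 ≤ n - k)
    (hd : minDist C = n - k) (hd' : minDist (dualCode C) = k)
    (hno : ∀ c ∈ dualCode C, wt c ≠ k + 1) :
    IsLeast {r : ℕ | HasLinearLocality C r} (k - 1) := by
  classical
  have : Nonempty ι := Fintype.card_pos_iff.mp (by omega)
  refine ⟨hasLinearLocality_of_dualCode fun i => ?_, fun r hr => ?_⟩
  swap
  · have := HasLinearLocality.minDist_dualCode_le hr
    omega
  by_contra! hi
  have herase : ∀ T : Finset ι, i ∉ T → T.card = k →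
      ∃ x ∈ dualCode C, ∀ j, x j ≠ 0 ↔ j ∈ T := by
    intro T hiT hT
    have hcard : (insert i T).card = k + 1 := by rw [Finset.card_insert_of_notMem hiT, hT]
    obtain ⟨x, hx, hx0, hxS⟩ :=
      exists_ne_zero_mem_dualCode_supported_on C (insert i T) (by omega)
    have hwt : wt x ≤ k := by
      have := wt_le_card_of_support_subset hxS
      have := hno x hx
      omega
    have hxi : x i = 0 := by
      by_contra h
      exact absurd (hi x hx h) (by omega)
    have hsub : (Finset.univ.filter fun j => x j ≠ 0) ⊆ T := fun j hj => by
      have hj : x j ≠ 0 := by simpa using hj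
      exact (Finset.mem_insert.mp (hxS j hj)).resolve_left fun h => hj (h ▸ hxi)
    have hsupp : wt x = (Finset.univ.filter fun j => x j ≠ 0).card :=
      wt_eq_card_of_forall_iff fun j => by simp
    have := minDist_le_wt hx hx0
    have hTeq := Finset.eq_of_subset_of_card_le hsub (by omega)
    exact ⟨x, hx, fun j => by simp [← hTeq]⟩
  obtain ⟨S, hSsub, hS⟩ := Finset.exists_subset_card_eq (s := Finset.univ.erase i) (n := k + 1)
    (by rw [Finset.card_erase_of_mem (Finset.mem_univ i), Finset.card_univ]; omega)
  have hiS : i ∉ S := fun h => Finset.notMem_erase i _ (hSsub h)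
  obtain ⟨a, ha, b, hb, hab⟩ := Finset.one_lt_card.mp (show 1 < S.card by omega)
  have hblock : ∀ a ∈ S, ∃ x ∈ dualCode C, ∀ j, x j ≠ 0 ↔ j ∈ S.erase a := fun a ha =>
    herase _ (fun h => hiS (Finset.mem_of_mem_erase h))
      (by rw [Finset.card_erase_of_mem ha, hS, Nat.add_sub_cancel])
  obtain ⟨x, hx, hxS⟩ := hblock a ha
  obtain ⟨y, hy, hyS⟩ := hblock b hb
  refine hab (eq_of_dualCode_support_eq_erase (by omega) (fun c hc hcS => ?_) ha hb hx hy hxS hyS)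
  by_contra hc0
  have hle := minDist_le_wt hc hc0
  have hwt : wt c ≤ Sᶜ.card := wt_le_card_of_support_subset fun j hj =>
    Finset.mem_compl.mpr fun h => hj (hcS j h)
  rw [Finset.card_compl] at hwt
  omega
end

section
/- Let C be a nontrivial near MDS (NMDS) code of length n and dimension k over GF(q), so that d(C) = n − k and d(C⊥) = k. If the intersection of the supports of all codewords of minimum weight k in C⊥ is empty, then C⊥ has minimum linear locality d(C) − 1 = n − k − 1. -/
open scoped BigOperators

variable {F : Type*} [Field F] {ι : Type*} [Fintype ι]

/-- A word orthogonal to the dual code belongs to the code. -/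
theorem mem_of_forall_mem_dualCode {C : Submodule F (ι → F)} {v : ι → F}
    (hv : ∀ x ∈ dualCode C, ∑ i, x i * v i = 0) : v ∈ C := by
  classical
  by_contra hvC
  obtain ⟨f, hfv, hfC⟩ := Submodule.exists_le_ker_of_notMem hvC
  have hf : ∀ c : ι → F, f c = ∑ i, f (Pi.single i 1) * c i := fun c => by
    rw [f.pi_apply_eq_sum_univ c]
    refine Finset.sum_congr rfl fun i _ => ?_
    rw [smul_eq_mul, mul_comm]
    congr 2
    ext j
    simp [Pi.single_apply, eq_comm]
  refine hfv ?_
  rw [hf]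
  refine hv (fun i => f (Pi.single i 1)) fun c hc => ?_
  rw [← hf]
  exact hfC hc

/-- If the support of a nonzero dual codeword has as many elements as the dimension of the code,
then some nonzero codeword vanishes on that support. -/
theorem exists_mem_ne_zero_vanishing_on_support {C : Submodule F (ι → F)} {x : ι → F}
    (hx : x ∈ dualCode C) (hx0 : x ≠ 0) (hwt : wt x = Module.finrank F C) :
    ∃ c ∈ C, c ≠ 0 ∧ ∀ i, x i ≠ 0 → c i = 0 := by
  classical
  by_contra! hno
  let f : C →ₗ[F] ({i // x i ≠ 0} → F) :=
    (LinearMap.funLeft F F (Subtype.val : {i // x i ≠ 0} → ι)).comp C.subtype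
  have hinj : Function.Injective f := by
    rw [injective_iff_map_eq_zero]
    rintro ⟨c, hc⟩ hfc
    by_contra hc0
    obtain ⟨i, hi, hci⟩ := hno c hc fun h => hc0 (Subtype.ext h)
    exact hci (congrFun hfc ⟨i, hi⟩)
  have hrank : Module.finrank F C = Module.finrank F ({i // x i ≠ 0} → F) := by
    rw [Module.finrank_fintype_fun_eq_card, ← hwt, wt, ← Nat.card_eq_fintype_card]
    rfl
  have hsurj := (LinearMap.injective_iff_surjective_of_finrank_eq_finrank hrank).1 hinj
  obtain ⟨s, hs⟩ := Function.ne_iff.1 hx0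
  obtain ⟨⟨c, hc⟩, hfc⟩ := hsurj (Pi.single ⟨s, hs⟩ 1)
  have hsum := hx c hc
  rw [Finset.sum_eq_single s] at hsum
  · have hcs : c s = 1 := by simpa [f] using congrFun hfc ⟨s, hs⟩
    exact hs (by simpa [hcs] using hsum)
  · intro j _ hjs
    by_cases hj : x j = 0
    · simp [hj]
    · have hcj : c j = 0 := by simpa [f, Pi.single_apply, hjs] using congrFun hfc ⟨j, hj⟩
      simp [hcj]
  · simp

/-- A codeword nonzero at `i` expresses the `i`-th symbol of the dual code through the remaining
symbols of its support. -/
theorem exists_recovery_of_mem {C : Submodule F (ι → F)} {c : ι → F} (hc : c ∈ C) {i : ι}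
    (hi : c i ≠ 0) :
    ∃ (R : Finset ι) (u : ι → F), i ∉ R ∧ R.card ≤ wt c - 1 ∧
      ∀ x ∈ dualCode C, x i = ∑ j ∈ R, u j * x j := by
  classical
  let S : Finset ι := {j | c j ≠ 0}
  have hiS : i ∈ S := by simp [S, hi]
  have hS : S.card = wt c := by
    rw [wt, ← Set.ncard_coe_finset]
    simp [S]
  refine ⟨S.erase i, fun j => -(c i)⁻¹ * c j, Finset.notMem_erase i S, ?_, fun x hx => ?_⟩
  · rw [Finset.card_erase_of_mem hiS, hS]
  · have hsum : ∑ j ∈ S, x j * c j = 0 := by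
      rw [← hx c hc]
      refine Finset.sum_subset (Finset.subset_univ S) fun j _ hj => ?_
      have hcj : c j = 0 := by simpa [S] using hj
      simp [hcj]
    rw [← Finset.add_sum_erase S _ hiS] at hsum
    have hR : ∑ j ∈ S.erase i, -(c i)⁻¹ * c j * x j
        = -(c i)⁻¹ * ∑ j ∈ S.erase i, x j * c j := by
      rw [Finset.mul_sum]
      exact Finset.sum_congr rfl fun j _ => by ring
    rw [hR, eq_neg_of_add_eq_zero_right hsum]
    field_simp

/-- The minimum distance of a code exceeds the linear locality of its dual by at most one. -/
theorem HasLinearLocality.minDist_le [Nonempty ι] {C : Submodule F (ι → F)} {r : ℕ}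
    (h : HasLinearLocality (dualCode C) r) : minDist C ≤ r + 1 := by
  classical
  obtain ⟨i⟩ := ‹Nonempty ι›
  obtain ⟨R, u, hiR, hcard, hu⟩ := h i
  let v : ι → F := fun j => if j = i then 1 else if j ∈ R then -u j else 0
  have hvi : v i = 1 := by simp [v]
  have hvR : ∀ j ∈ R, v j = -u j := fun j hj => by
    have hji : j ≠ i := fun h => hiR (h ▸ hj)
    simp [v, hji, hj]
  have hv : ∀ j ∉ insert i R, v j = 0 := fun j hj => by
    rw [Finset.mem_insert, not_or] at hj
    simp [v, hj.1, hj.2]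
  have hvC : v ∈ C := mem_of_forall_mem_dualCode fun x hx => by
    rw [← Finset.sum_subset (Finset.subset_univ (insert i R))
      (fun j _ hj => by rw [hv j hj, mul_zero]), Finset.sum_insert hiR, hvi, hu x hx, mul_one,
      ← Finset.sum_add_distrib]
    exact Finset.sum_eq_zero fun j hj => by rw [hvR j hj]; ring
  have hv0 : v ≠ 0 := fun h => by simp [h] at hvi
  have hsub : {j | v j ≠ 0} ⊆ (insert i R : Finset ι) := fun j hj => by
    by_contra hjR
    exact hj (hv j hjR)
  calc minDist C ≤ wt v := minDist_le_wt hvC hv0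
    _ ≤ (insert i R).card := by
      rw [← Set.ncard_coe_finset]
      exact Set.ncard_le_ncard hsub (Finset.finite_toSet _)
    _ ≤ r + 1 := (Finset.card_insert_le i R).trans (Nat.add_le_add_right hcard 1)

/-- Let `C` be a nontrivial NMDS code of length `n` and dimension `k`. If the
intersection of the supports of all codewords of minimum weight `k` in `C⊥` is empty, then
`C⊥` has minimum linear locality `d(C) - 1 = n - k - 1`. -/
theorem statement16 (C : Submodule F (ι → F)) (n k : ℕ)
    (hn : Fintype.card ι = n) (hk : Module.finrank F C = k)
    (hk2 : 2 ≤ k) (hnk2 : 2 ≤ n - k)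
    (hd : minDist C = n - k) (hd' : minDist (dualCode C) = k)
    (hint : (⋂ c ∈ {c : ι → F | c ∈ dualCode C ∧ wt c = k}, {i | c i ≠ 0}) = ∅) :
    IsLeast {r : ℕ | HasLinearLocality (dualCode C) r} (n - k - 1) := by
  have hne : Nonempty ι := Fintype.card_pos_iff.1 (by omega)
  refine ⟨fun i => ?_, fun r hr => ?_⟩
  · have hi := Set.eq_empty_iff_forall_notMem.1 hint i
    simp only [Set.mem_iInter, not_forall] at hi
    obtain ⟨x, ⟨hx, hxk⟩, hxi⟩ := hi
    have hxi : x i = 0 := by simpa using hxi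
    have hx0 : x ≠ 0 := by
      rintro rfl
      simp [wt] at hxk
      omega
    obtain ⟨c, hc, hc0, hcx⟩ :=
      exists_mem_ne_zero_vanishing_on_support hx hx0 (hxk.trans hk.symm)
    have hsub : {j | c j ≠ 0} ⊆ {j | x j ≠ 0}ᶜ := fun j hj hxj => hj (hcx j hxj)
    have hcompl : ({j | x j ≠ 0}ᶜ : Set ι).ncard = n - k := by
      have h := Set.ncard_add_ncard_compl {j | x j ≠ 0}
      rw [Nat.card_eq_fintype_card, hn] at h
      rw [wt] at hxk
      omega
    have hle : n - k ≤ wt c := hd ▸ minDist_le_wt hc hc0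
    have heq : {j | c j ≠ 0} = {j | x j ≠ 0}ᶜ :=
      Set.eq_of_subset_of_ncard_le hsub (hcompl.trans_le hle)
    have hwt : wt c = n - k := by rw [wt, heq, hcompl]
    have hci : i ∈ {j | c j ≠ 0} := by rw [heq]; simpa using hxi
    exact hwt ▸ exists_recovery_of_mem hc hci
  · have h := HasLinearLocality.minDist_le hr
    omega
end

section
/- Let m ≥ 3 be odd, let q = 2^m, and let f be an oval polynomial over GF(q) all of whose coefficients lie in the prime subfield GF(2) = {0, 1}. Then the equation f(x) + x + 1 = 0 has no solution x ∈ GF(q). -/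
/-- `f` is an oval polynomial on the finite field `F` (of characteristic `2` in applications):
`deg f < |F|`, `f(0) = 0`, `f(1) = 1`, `f` is a permutation polynomial, and for every `a`,
`x ↦ (f(x + a) + f(a)) * x^(|F| - 2)` is a permutation of `F`. -/
def IsOvalPoly {F : Type*} [Field F] [Fintype F] (f : Polynomial F) : Prop :=
  f.natDegree < Fintype.card F ∧ f.eval 0 = 0 ∧ f.eval 1 = 1 ∧
  Function.Bijective (fun x : F => f.eval x) ∧
  ∀ a : F, Function.Bijective (fun x : F => (f.eval (x + a) + f.eval a) * x ^ (Fintype.card F - 2))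

open Polynomial in
/-- A polynomial with coefficients in `{0, 1}` commutes with squaring in characteristic two. -/
theorem eval_sq_of_coeff_zero_or_one {R : Type*} [CommRing R] [CharP R 2] {f : R[X]}
    (hcoef : ∀ k : ℕ, f.coeff k = 0 ∨ f.coeff k = 1) (x : R) :
    f.eval (x ^ 2) = f.eval x ^ 2 := by
  have : Fact (Nat.Prime 2) := ⟨Nat.prime_two⟩
  rw [eval_eq_sum_range, eval_eq_sum_range, sum_pow_char]
  refine Finset.sum_congr rfl fun k _ => ?_
  rcases hcoef k with h | h <;> simp [h, ← pow_mul, mul_comm]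

/-- In a field with `2 ^ m` elements, `m` odd, the only solutions of `x ^ 4 = x` are `0` and `1`. -/
theorem eq_zero_or_one_of_pow_four_eq {F : Type*} [Field F] [Fintype F] {m : ℕ} (hodd : Odd m)
    (hF : Fintype.card F = 2 ^ m) {x : F} (hx : x ^ 4 = x) : x = 0 ∨ x = 1 := by
  obtain ⟨k, rfl⟩ := hodd
  have h4 : ∀ n : ℕ, x ^ 4 ^ n = x := by
    intro n
    induction n with
    | zero => simp
    | succ n ih => rw [pow_succ, pow_mul, ih, hx]
  have h : x ^ 2 = x := by
    have := FiniteField.pow_card x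
    rwa [hF, pow_succ, pow_mul, pow_mul, show 2 ^ 2 = 4 from rfl, h4] at this
  have h' : x * (x - 1) = 0 := by linear_combination h
  exact (mul_eq_zero.mp h').imp id sub_eq_zero.mp

/-- The graph of an oval polynomial meets a line `y = x + c` in at most two points. -/
theorem IsOvalPoly.eq_of_eval_eq_add {F : Type*} [Field F] [Fintype F] [CharP F 2]
    {f : Polynomial F} (hf : IsOvalPoly f) {c x y z : F} (hx : f.eval x = x + c)
    (hy : f.eval y = y + c) (hz : f.eval z = z + c) (hxy : y ≠ x) (hxz : z ≠ x) : y = z := by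
  have slope : ∀ w : F, f.eval w = w + c → w ≠ x →
      (f.eval (w - x + x) + f.eval x) * (w - x) ^ (Fintype.card F - 2) = 1 := by
    intro w hw hwx
    have hcard : Fintype.card F - 2 + 1 = Fintype.card F - 1 := by
      have := Fintype.one_lt_card (α := F)
      omega
    have hsum : f.eval (w - x + x) + f.eval x = w - x := by
      rw [sub_add_cancel, hw, hx]
      linear_combination (x + c) * CharTwo.two_eq_zero (R := F)
    rw [hsum, ← pow_succ', hcard]
    exact FiniteField.pow_card_sub_one_eq_one _ (sub_ne_zero.mpr hwx)
  exact sub_left_injective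
    ((hf.2.2.2.2 x).injective ((slope y hy hxy).trans (slope z hz hxz).symm))

/-- Let `m ≥ 3` be odd, `q = 2^m`, and let `f` be an oval polynomial over
`GF(q)` all of whose coefficients lie in `GF(2) = {0, 1}`. Then `f(x) + x + 1 = 0` has no
solution in `GF(q)`. -/
theorem statement18 {F : Type*} [Field F] [Fintype F] (m : ℕ) (hm : 3 ≤ m) (hodd : Odd m)
    (hF : Fintype.card F = 2 ^ m) (f : Polynomial F) (hf : IsOvalPoly f)
    (hcoef : ∀ k : ℕ, f.coeff k = 0 ∨ f.coeff k = 1) :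
    ∀ x : F, f.eval x + x + 1 ≠ 0 := by
  have : Fact (Nat.Prime 2) := ⟨Nat.prime_two⟩
  have : CharP F 2 := charP_of_card_eq_prime_pow hF
  have h2 : (2 : F) = 0 := CharTwo.two_eq_zero
  intro x h
  have hsq : ∀ y : F, f.eval y = y + 1 → f.eval (y ^ 2) = y ^ 2 + 1 := by
    intro y hy
    rw [eval_sq_of_coeff_zero_or_one hcoef, hy]
    linear_combination y * h2
  have hx : f.eval x = x + 1 := by linear_combination h - (x + 1) * h2
  have hx0 : x ≠ 0 := by
    rintro rfl
    simp [hf.2.1] at hx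
  have hx1 : x ≠ 1 := by
    rintro rfl
    simp [hf.2.2.1] at hx
  have hne4 : x ^ 4 ≠ x := fun h4 =>
    (eq_zero_or_one_of_pow_four_eq hodd hF h4).elim hx0 hx1
  have hne2 : x ^ 2 ≠ x := fun h2 => hne4 (by rw [show 4 = 2 * 2 from rfl, pow_mul, h2, h2])
  have hx4 : f.eval (x ^ 4) = x ^ 4 + 1 := by
    have := hsq _ (hsq x hx)
    rwa [← pow_mul] at this
  have h24 : x ^ 2 = x ^ 4 := hf.eq_of_eval_eq_add hx (hsq x hx) hx4 hne2 hne4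
  have hinj : x ^ 2 = x := by
    have : (x ^ 2 - x) ^ 2 = 0 := by
      linear_combination (x ^ 2 - x ^ 3) * h2 - h24
    exact sub_eq_zero.mp (pow_eq_zero_iff two_ne_zero |>.mp this)
  exact hne2 hinj
end

section
/- Let m ≥ 3 be odd, q = 2^m, let f be an oval polynomial over GF(q) all of whose coefficients lie in GF(2) = {0, 1}, and let α be a generator of the multiplicative group GF(q)*. Let C_f be the linear code of length q + 1 over GF(q) given by C_f = { ( (a·f(α^i) + b·α^i + c)_{i=0,...,q−2}, b + c, a + c ) : a, b, c ∈ GF(q) } (the code with generator matrix G_f whose columns are (f(α^i), α^i, 1)ᵀ for i = 0, ..., q − 2, followed by (0, 1, 1)ᵀ and (1, 0, 1)ᵀ). Then the dual code C_f⊥ has minimum linear locality q − 3 = d(C_f) − 1, while C_f itself has minimum linear locality 3 = d(C_f⊥); in particular, the minimum linear locality of C_f is strictly greater than d(C_f⊥) − 1. -/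
open scoped BigOperators

variable {F : Type*} [Field F] {ι : Type*} [Fintype ι]

/-- The code `C_f` of length `q + 1` attached to an oval polynomial `f` and a generator `α` of
`GF(q)*`: the code with generator matrix whose columns are `(f(α^i), α^i, 1)ᵀ` for
`i = 0, ..., q - 2`, followed by `(0, 1, 1)ᵀ` and `(1, 0, 1)ᵀ`. -/
def ovalCode {F : Type*} [Field F] [Fintype F] (f : Polynomial F) (α : F) :
    Submodule F (Fin (Fintype.card F + 1) → F) where
  carrier := {c | ∃ a b d : F, ∀ i : Fin (Fintype.card F + 1),
    c i = if (i : ℕ) < Fintype.card F - 1 then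
            a * f.eval (α ^ (i : ℕ)) + b * α ^ (i : ℕ) + d
          else if (i : ℕ) = Fintype.card F - 1 then b + d else a + d}
  add_mem' := by
    rintro x y ⟨a, b, d, hx⟩ ⟨a', b', d', hy⟩
    refine ⟨a + a', b + b', d + d', fun i => ?_⟩
    simp only [Pi.add_apply, hx i, hy i]
    split_ifs <;> ring
  zero_mem' := ⟨0, 0, 0, fun i => by
    simp only [Pi.zero_apply]; split_ifs <;> ring⟩
  smul_mem' := by
    rintro r x ⟨a, b, d, hx⟩
    refine ⟨r * a, r * b, r * d, fun i => ?_⟩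
    simp only [Pi.smul_apply, smul_eq_mul, hx i]
    split_ifs <;> ring

section LinearCodes

variable {C : Submodule F (ι → F)}

lemma mem_dualCode {x : ι → F} : x ∈ dualCode C ↔ ∀ c ∈ C, ∑ i, x i * c i = 0 :=
  Iff.rfl

lemma wt_le_card {c : ι → F} (T : Finset ι) (h : ∀ i, c i ≠ 0 → i ∈ T) : wt c ≤ T.card := by
  rw [wt, ← Set.ncard_coe_finset]
  exact Set.ncard_le_ncard h T.finite_toSet

lemma card_le_wt {c : ι → F} (T : Finset ι) (h : ∀ i ∈ T, c i ≠ 0) : T.card ≤ wt c := by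
  rw [wt, ← Set.ncard_coe_finset]
  exact Set.ncard_le_ncard h (Set.toFinite _)

/-- A finite-dimensional code is its own double dual. -/
lemma dualCode_dualCode (C : Submodule F (ι → F)) : dualCode (dualCode C) = C := by
  classical
  apply le_antisymm
  · intro x hx
    by_contra hxC
    obtain ⟨φ, hφx, hφC⟩ := Submodule.exists_le_ker_of_notMem hxC
    have key : ∀ y : ι → F, φ y = ∑ i, φ (Pi.single i 1) * y i := by
      intro y
      rw [LinearMap.pi_apply_eq_sum_univ φ y]
      refine Finset.sum_congr rfl fun i _ => ?_
      rw [smul_eq_mul, mul_comm]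
      congr 2
      ext j
      simp [Pi.single_apply, eq_comm]
    have hmem : (fun i => φ (Pi.single i 1)) ∈ dualCode C := by
      intro c hc
      rw [← key]
      exact hφC hc
    apply hφx
    rw [key, ← hx _ hmem]
    exact Finset.sum_congr rfl fun i _ => mul_comm _ _
  · intro c hc x hx
    rw [← hx c hc]
    exact Finset.sum_congr rfl fun i _ => mul_comm _ _

/-- Linear locality `r` means that every coordinate lies in the support of a dual codeword of
weight at most `r + 1`. -/
lemma hasLinearLocality_iff {r : ℕ} :
    HasLinearLocality C r ↔ ∀ i, ∃ w ∈ dualCode C, w i ≠ 0 ∧ wt w ≤ r + 1 := by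
  classical
  refine forall_congr' fun i => ⟨?_, ?_⟩
  · rintro ⟨R, u, hi, hR, h⟩
    refine ⟨fun j => if j = i then 1 else if j ∈ R then -u j else 0, ?_, by simp, ?_⟩
    · intro c hc
      rw [← Finset.add_sum_erase _ _ (Finset.mem_univ i)]
      have hsub : R ⊆ Finset.univ.erase i := fun j hj =>
        Finset.mem_erase.2 ⟨fun e => hi (e ▸ hj), Finset.mem_univ j⟩
      rw [← Finset.sum_subset hsub]
      · have : ∑ j ∈ R, (if j = i then 1 else if j ∈ R then -u j else 0) * c j =
            -∑ j ∈ R, u j * c j := by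
          rw [← Finset.sum_neg_distrib]
          refine Finset.sum_congr rfl fun j hj => ?_
          rw [if_neg (fun e : j = i => hi (e ▸ hj)), if_pos hj, neg_mul]
        rw [this, ← h c hc]
        simp
      · intro j hj hjR
        simp [Finset.ne_of_mem_erase hj, hjR]
    · refine (wt_le_card (insert i R) fun j hj => ?_).trans
        ((Finset.card_insert_le i R).trans (Nat.succ_le_succ hR))
      by_contra hn
      rw [Finset.mem_insert, not_or] at hn
      exact hj (by rw [if_neg hn.1, if_neg hn.2])
  · rintro ⟨w, hw, hwi, hwt⟩
    refine ⟨Finset.univ.filter fun j => w j ≠ 0 ∧ j ≠ i, fun j => -w j / w i, by simp, ?_, ?_⟩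
    · have h := card_le_wt (c := w) (insert i (Finset.univ.filter fun j => w j ≠ 0 ∧ j ≠ i)) (by
        intro j hj
        rcases Finset.mem_insert.1 hj with rfl | hj
        · exact hwi
        · exact (Finset.mem_filter.1 hj).2.1)
      rw [Finset.card_insert_of_notMem (by simp)] at h
      omega
    · intro c hc
      have h := hw c hc
      rw [← Finset.add_sum_erase _ _ (Finset.mem_univ i)] at h
      have hsub : (Finset.univ.filter fun j => w j ≠ 0 ∧ j ≠ i) ⊆ Finset.univ.erase i := by
        intro j hj
        simpa using (Finset.mem_filter.1 hj).2.2
      rw [← Finset.sum_subset hsub] at h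
      · have e : ∑ j with w j ≠ 0 ∧ j ≠ i, -w j / w i * c j =
            -(∑ j with w j ≠ 0 ∧ j ≠ i, w j * c j) / w i := by
          rw [← Finset.sum_neg_distrib, Finset.sum_div]
          exact Finset.sum_congr rfl fun j _ => by ring
        rw [e, eq_div_iff hwi]
        linear_combination h
      · intro j hj hjn
        have : w j = 0 := by
          by_contra hne
          exact hjn (by simpa using ⟨hne, Finset.ne_of_mem_erase hj⟩)
        rw [this, zero_mul]

lemma minDist_eq {w : ℕ} (hex : ∃ c ∈ C, c ≠ 0 ∧ wt c = w)
    (hle : ∀ c ∈ C, c ≠ 0 → w ≤ wt c) : minDist C = w :=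
  IsLeast.csInf_eq ⟨hex, by rintro _ ⟨c, hc, h0, rfl⟩; exact hle c hc h0⟩

/-- The weight of a word is the length minus the number of its zeros. -/
lemma wt_add_card_zeros [DecidableEq F] (c : ι → F) :
    wt c + (Finset.univ.filter fun i => c i = 0).card = Fintype.card ι := by
  have : wt c = (Finset.univ.filter fun i => ¬ c i = 0).card := by
    rw [wt, ← Set.ncard_coe_finset]
    congr 1
    ext i
    simp
  rw [this, add_comm, Finset.card_filter_add_card_filter_not]
  rfl

/-- If codewords separate `i` from any `r` other coordinates, then every dual codeword that is
nonzero at `i` has weight greater than `r + 1`. -/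
lemma lt_wt_of_separates {r : ℕ} {i : ι} {w : ι → F} (hw : w ∈ dualCode C) (hi : w i ≠ 0)
    (hr : r + 1 ≤ Fintype.card ι)
    (h : ∀ R : Finset ι, R.card = r → i ∉ R → ∃ c ∈ C, c i ≠ 0 ∧ ∀ j ∈ R, c j = 0) :
    r + 1 < wt w := by
  classical
  by_contra hle
  have hcard : (Finset.univ.filter fun j => w j ≠ 0).card ≤ r + 1 :=
    (card_le_wt _ fun j hj => (Finset.mem_filter.1 hj).2).trans (not_lt.1 hle)
  obtain ⟨T, hT, hTc⟩ := Finset.exists_superset_card_eq hcard hr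
  have hiT : i ∈ T := hT (by simpa using hi)
  obtain ⟨c, hc, hci, hcR⟩ := h (T.erase i) (by rw [Finset.card_erase_of_mem hiT, hTc]; rfl)
    (Finset.notMem_erase i T)
  have hs := hw c hc
  rw [Finset.sum_eq_single i] at hs
  · exact (mul_ne_zero hi hci) hs
  · intro j _ hji
    by_cases hj : j ∈ T
    · rw [hcR j (Finset.mem_erase.2 ⟨hji, hj⟩), mul_zero]
    · have : w j = 0 := by
        by_contra hne
        exact hj (hT (by simpa using hne))
      rw [this, zero_mul]
  · simp

end LinearCodes

section OvalPolynomials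

variable {K : Type*} [Field K] [Fintype K] {f : Polynomial K}

lemma IsOvalPoly.eval_injective (hf : IsOvalPoly f) : Function.Injective fun x => f.eval x :=
  hf.2.2.2.1.1

variable [CharP K 2]

/-- No three points of the graph of an oval polynomial are collinear. -/
lemma IsOvalPoly.not_collinear (hf : IsOvalPoly f) (hq : 2 < Fintype.card K) {x y z : K}
    (hxy : x ≠ y) (hxz : x ≠ z) (hyz : y ≠ z) :
    (f.eval y - f.eval x) * (z - x) - (f.eval z - f.eval x) * (y - x) ≠ 0 := by
  intro h
  have hinv : ∀ t : K, t ≠ 0 → t ^ (Fintype.card K - 2) = t⁻¹ := by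
    intro t ht
    apply eq_inv_of_mul_eq_one_left
    rw [← pow_succ, show Fintype.card K - 2 + 1 = Fintype.card K - 1 by omega]
    exact FiniteField.pow_card_sub_one_eq_one t ht
  have hy : y - x ≠ 0 := sub_ne_zero.2 hxy.symm
  have hz : z - x ≠ 0 := sub_ne_zero.2 hxz.symm
  have key : y - x = z - x := by
    apply (hf.2.2.2.2 x).1
    simp only [sub_add_cancel]
    rw [hinv _ hy, hinv _ hz, ← CharTwo.sub_eq_add, ← CharTwo.sub_eq_add,
      ← div_eq_mul_inv, ← div_eq_mul_inv, div_eq_div_iff hy hz]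
    linear_combination h
  exact hyz (sub_left_injective key)

/-- Every nonzero slope is attained by a chord of the graph of an oval polynomial through a given
point. -/
lemma IsOvalPoly.exists_chord (hf : IsOvalPoly f) (hq : 2 < Fintype.card K) (x : K) {t : K}
    (ht : t ≠ 0) : ∃ y, y ≠ x ∧ f.eval y - f.eval x = t * (y - x) := by
  obtain ⟨z, hz⟩ := (hf.2.2.2.2 x).2 t
  simp only at hz
  have hz0 : z ≠ 0 := by
    rintro rfl
    rw [zero_pow (by omega), mul_zero] at hz
    exact ht hz.symm
  refine ⟨z + x, by simpa using hz0, ?_⟩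
  have h1 : z ^ (Fintype.card K - 2) * z = 1 := by
    rw [← pow_succ, show Fintype.card K - 2 + 1 = Fintype.card K - 1 by omega]
    exact FiniteField.pow_card_sub_one_eq_one z hz0
  rw [CharTwo.sub_eq_add, add_sub_cancel_right, ← hz, mul_assoc, h1, mul_one]

/-- Each point of the graph over `x ≠ 0, 1` lies on a secant through `(0, 1)`. -/
lemma IsOvalPoly.exists_secant_zero_one (hf : IsOvalPoly f) (hq : 2 < Fintype.card K) {x : K}
    (h0 : x ≠ 0) (h1 : x ≠ 1) :
    ∃ t y, y ≠ x ∧ y ≠ 0 ∧ f.eval x + t * x + t = 0 ∧ f.eval y + t * y + t = 0 := by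
  have two : (2 : K) = 0 := CharTwo.two_eq_zero
  have hx1 : x + 1 ≠ 0 := fun h => h1 (by linear_combination h - two)
  have hfx : f.eval x ≠ 0 := fun h => h0 (hf.eval_injective (h.trans hf.2.1.symm))
  obtain ⟨t, ht⟩ : ∃ t, f.eval x = t * (x + 1) := ⟨f.eval x / (x + 1), by field_simp⟩
  have ht0 : t ≠ 0 := by rintro rfl; exact hfx (by rw [ht, zero_mul])
  obtain ⟨y, hyx, hy⟩ := hf.exists_chord hq x ht0
  refine ⟨t, y, hyx, ?_, by linear_combination ht + (t * x + t) * two,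
    by linear_combination ht + hy + (t * y + t) * two⟩
  rintro rfl
  rw [hf.2.1] at hy
  exact ht0 (by linear_combination - hy - ht)

/-- Each point of the graph over `x ≠ 0, 1` lies on a secant through `(1, 0)`. -/
lemma IsOvalPoly.exists_secant_one_zero (hf : IsOvalPoly f) (hq : 2 < Fintype.card K) {x : K}
    (h0 : x ≠ 0) (h1 : x ≠ 1) :
    ∃ t y, y ≠ x ∧ y ≠ 0 ∧ f.eval x + t * x + 1 = 0 ∧ f.eval y + t * y + 1 = 0 := by
  have two : (2 : K) = 0 := CharTwo.two_eq_zero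
  obtain ⟨t, ht⟩ : ∃ t, f.eval x + 1 = t * x := ⟨(f.eval x + 1) / x, by field_simp⟩
  have ht0 : t ≠ 0 := by
    rintro rfl
    exact h1 (hf.eval_injective (show f.eval x = f.eval 1 by
      rw [hf.2.2.1]; linear_combination ht - two))
  obtain ⟨y, hyx, hy⟩ := hf.exists_chord hq x ht0
  refine ⟨t, y, hyx, ?_, by linear_combination ht + (t * x) * two,
    by linear_combination ht + hy + (t * y) * two⟩
  rintro rfl
  rw [hf.2.1] at hy
  exact one_ne_zero (show (1 : K) = 0 by linear_combination ht + hy)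

/-- The evaluation of a polynomial with coefficients in `{0, 1}` commutes with squaring. -/
lemma eval_sq_of_coeff (hcoef : ∀ k, f.coeff k = 0 ∨ f.coeff k = 1) (x : K) :
    f.eval (x ^ 2) = f.eval x ^ 2 := by
  have hmap : f.map (frobenius K 2) = f := by
    ext k
    rw [Polynomial.coeff_map]
    rcases hcoef k with h | h <;> simp [h]
  have h := Polynomial.eval₂_hom (p := f) (frobenius K 2) x
  rw [← Polynomial.eval_map, hmap] at h
  simpa [frobenius_def] using h

/-- A finite field of order `2 ^ m` with `m` odd has no proper element of `GF(4)`. -/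
lemma eq_zero_or_one_of_pow_four {m : ℕ} (hodd : Odd m) (hK : Fintype.card K = 2 ^ m) {x : K}
    (hx : x ^ 4 = x) : x = 0 ∨ x = 1 := by
  obtain ⟨k, rfl⟩ := hodd
  have h4 : ∀ n : ℕ, x ^ 4 ^ n = x := by
    intro n
    induction n with
    | zero => simp
    | succ n ih => rw [pow_succ, pow_mul, ih, hx]
  have h := FiniteField.pow_card x
  rw [hK, pow_succ, pow_mul 2 2 k, pow_mul x, show (2 : ℕ) ^ 2 = 4 by norm_num, h4] at h
  have : x * (x - 1) = 0 := by linear_combination h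
  rcases mul_eq_zero.1 this with h | h
  · exact Or.inl h
  · exact Or.inr (sub_eq_zero.1 h)

/-- The line through `(0, 1)` and `(1, 0)` misses the graph of `f`. -/
lemma IsOvalPoly.eval_ne_add_one (hf : IsOvalPoly f) {m : ℕ} (hm : 2 ≤ m) (hodd : Odd m)
    (hK : Fintype.card K = 2 ^ m) (hcoef : ∀ k, f.coeff k = 0 ∨ f.coeff k = 1) (x : K) :
    f.eval x + x + 1 ≠ 0 := by
  have two : (2 : K) = 0 := CharTwo.two_eq_zero
  have hq : 2 < Fintype.card K := by
    rw [hK]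
    calc 2 < 2 ^ 2 := by norm_num
      _ ≤ 2 ^ m := Nat.pow_le_pow_right (by norm_num) hm
  intro h
  have hsq : ∀ y : K, f.eval y + y + 1 = 0 → f.eval (y ^ 2) + y ^ 2 + 1 = 0 := by
    intro y hy
    rw [eval_sq_of_coeff hcoef]
    linear_combination (f.eval y + y + 1) * hy - (f.eval y * y + f.eval y + y) * two
  have hne : ∀ y : K, f.eval y + y + 1 = 0 → y ^ 4 ≠ y := by
    intro y hy h4
    rcases eq_zero_or_one_of_pow_four hodd hK h4 with rfl | rfl
    · rw [hf.2.1] at hy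
      exact one_ne_zero (show (1 : K) = 0 by linear_combination hy)
    · rw [hf.2.2.1] at hy
      exact one_ne_zero (show (1 : K) = 0 by linear_combination hy - two)
  have hne2 : ∀ y : K, f.eval y + y + 1 = 0 → y ≠ y ^ 2 := by
    intro y hy h2
    exact hne y hy (by linear_combination (-1 - y - y ^ 2) * h2)
  have hx2 := hsq x h
  have hx4 := hsq _ hx2
  rw [← pow_mul] at hx4
  have hc := hf.not_collinear hq (hne2 x h) (hne x h).symm
    (by simpa [← pow_mul] using hne2 _ hx2)
  apply hc
  linear_combination (x ^ 4 - x) * (hx2 - h) - (x ^ 2 - x) * (hx4 - h)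

end OvalPolynomials

section OvalArrangements

variable {K : Type*} [Field K] [Fintype K] {f : Polynomial K}

/-- The affine points `(Y i, X i)` are `P = (0, 1)`, `Q = (1, 0)`, and the points `(f(x), x)` with
`x ≠ 0`, each listed once. -/
structure IsOvalArrangement (f : Polynomial K) (X Y : ι → K) (P Q : ι) : Prop where
  X_P : X P = 1
  Y_P : Y P = 0
  X_Q : X Q = 0
  Y_Q : Y Q = 1
  X_ne_zero : ∀ i, i ≠ P → i ≠ Q → X i ≠ 0
  Y_eq : ∀ i, i ≠ P → i ≠ Q → Y i = f.eval (X i)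
  exists_index : ∀ x, x ≠ 0 → ∃ i, i ≠ P ∧ i ≠ Q ∧ X i = x
  injOn : ∀ i j, i ≠ P → i ≠ Q → j ≠ P → j ≠ Q → X i = X j → i = j

namespace IsOvalArrangement

variable {X Y : ι → K} {P Q : ι}

lemma P_ne_Q (A : IsOvalArrangement f X Y P Q) : P ≠ Q := by
  rintro rfl
  exact zero_ne_one (A.X_Q.symm.trans A.X_P)

lemma X_ne_or_Y_ne (A : IsOvalArrangement f X Y P Q) (hf : IsOvalPoly f) {i j : ι} (hij : i ≠ j) :
    X i ≠ X j ∨ Y i ≠ Y j := by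
  have hP : ∀ j, j ≠ P → Y j ≠ Y P := by
    intro j hj
    rw [A.Y_P]
    by_cases hQ : j = Q
    · rw [hQ, A.Y_Q]
      exact one_ne_zero
    · rw [A.Y_eq j hj hQ]
      exact fun h => A.X_ne_zero j hj hQ (hf.eval_injective (h.trans hf.2.1.symm))
  have hQ : ∀ j, j ≠ Q → X j ≠ X Q := by
    intro j hj
    rw [A.X_Q]
    by_cases hP : j = P
    · rw [hP, A.X_P]
      exact one_ne_zero
    · exact A.X_ne_zero j hP hj
  by_cases hiP : i = P
  · subst hiP
    exact Or.inr (hP j hij.symm).symm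
  by_cases hiQ : i = Q
  · subst hiQ
    exact Or.inl (hQ j hij.symm).symm
  by_cases hjP : j = P
  · subst hjP
    exact Or.inr (hP i hij)
  by_cases hjQ : j = Q
  · subst hjQ
    exact Or.inl (hQ i hij)
  exact Or.inl fun h => hij (A.injOn i j hiP hiQ hjP hjQ h)

variable [CharP K 2]

/-- No three of the points `(f(x), x)` are collinear. -/
lemma not_collinear (A : IsOvalArrangement f X Y P Q) (hf : IsOvalPoly f)
    (hq : 2 < Fintype.card K) {i j k : ι} (hi : i ≠ P ∧ i ≠ Q) (hj : j ≠ P ∧ j ≠ Q)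
    (hk : k ≠ P ∧ k ≠ Q) (hij : i ≠ j) (hik : i ≠ k) (hjk : j ≠ k) :
    (Y j - Y i) * (X k - X i) - (Y k - Y i) * (X j - X i) ≠ 0 := by
  rw [A.Y_eq i hi.1 hi.2, A.Y_eq j hj.1 hj.2, A.Y_eq k hk.1 hk.2]
  exact hf.not_collinear hq (fun h => hij (A.injOn _ _ hi.1 hi.2 hj.1 hj.2 h))
    (fun h => hik (A.injOn _ _ hi.1 hi.2 hk.1 hk.2 h))
    (fun h => hjk (A.injOn _ _ hj.1 hj.2 hk.1 hk.2 h))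

/-- The point `(1, 1)` is collinear with no two others. -/
lemma not_collinear_of_X_eq_one (A : IsOvalArrangement f X Y P Q) (hf : IsOvalPoly f)
    (hq : 2 < Fintype.card K) {i j k : ι} (hi : i ≠ P ∧ i ≠ Q) (hi1 : X i = 1)
    (hij : i ≠ j) (hik : i ≠ k) (hjk : j ≠ k) :
    (Y j - Y i) * (X k - X i) - (Y k - Y i) * (X j - X i) ≠ 0 := by
  have hYi : Y i = 1 := by rw [A.Y_eq i hi.1 hi.2, hi1, hf.2.2.1]
  have hX : ∀ l, i ≠ l → l ≠ P → X l - 1 ≠ 0 := by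
    intro l hil hlP h
    by_cases hlQ : l = Q
    · rw [hlQ, A.X_Q, zero_sub, neg_eq_zero] at h
      exact one_ne_zero h
    · exact hil (A.injOn i l hi.1 hi.2 hlP hlQ (hi1.trans (sub_eq_zero.1 h).symm))
  have hY : ∀ l, i ≠ l → l ≠ Q → Y l - 1 ≠ 0 := by
    intro l hil hlQ h
    by_cases hlP : l = P
    · rw [hlP, A.Y_P, zero_sub, neg_eq_zero] at h
      exact one_ne_zero h
    · rw [A.Y_eq l hlP hlQ, sub_eq_zero, ← hf.2.2.1] at h
      exact hil (A.injOn i l hi.1 hi.2 hlP hlQ (hi1.trans (hf.eval_injective h).symm))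
  rw [hi1, hYi]
  by_cases hjP : j = P
  · rw [hjP, A.X_P, sub_self, mul_zero, sub_zero]
    exact mul_ne_zero (hY P (hjP ▸ hij) A.P_ne_Q) (hX k hik (hjP ▸ hjk.symm))
  by_cases hkP : k = P
  · rw [hkP, A.X_P, sub_self, mul_zero, zero_sub, neg_ne_zero]
    exact mul_ne_zero (hY P (hkP ▸ hik) A.P_ne_Q) (hX j hij hjP)
  by_cases hjQ : j = Q
  · rw [hjQ, A.Y_Q, sub_self, zero_mul, zero_sub, neg_ne_zero]
    exact mul_ne_zero (hY k hik (hjQ ▸ hjk.symm)) (hX Q (hjQ ▸ hij) A.P_ne_Q.symm)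
  by_cases hkQ : k = Q
  · rw [hkQ, A.Y_Q, sub_self, zero_mul, sub_zero]
    exact mul_ne_zero (hY j hij hjQ) (hX Q (hkQ ▸ hik) A.P_ne_Q.symm)
  have := A.not_collinear hf hq hi ⟨hjP, hjQ⟩ ⟨hkP, hkQ⟩ hij hik hjk
  rwa [hi1, hYi] at this

/-- A line contains at most three points of the arrangement. -/
lemma card_line_le [DecidableEq K] (A : IsOvalArrangement f X Y P Q) (hf : IsOvalPoly f)
    (hq : 2 < Fintype.card K) (hline : ∀ x, f.eval x + x + 1 ≠ 0) {a b d : K}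
    (h0 : a ≠ 0 ∨ b ≠ 0 ∨ d ≠ 0) :
    (Finset.univ.filter fun i => a * Y i + b * X i + d = 0).card ≤ 3 := by
  classical
  have two : (2 : K) = 0 := CharTwo.two_eq_zero
  set Z := Finset.univ.filter fun i => a * Y i + b * X i + d = 0 with hZ
  have hmem : ∀ i, i ∈ Z ↔ a * Y i + b * X i + d = 0 := by simp [hZ]
  set G := Z.filter fun i => i ≠ P ∧ i ≠ Q with hG
  have hG2 : G.card ≤ 2 := by
    by_contra hlt
    obtain ⟨i, hi, j, hj, k, hk, hij, hik, hjk⟩ := Finset.two_lt_card.1 (not_le.1 hlt)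
    rw [hG, Finset.mem_filter, hmem] at hi hj hk
    obtain ⟨ei, hi⟩ := hi
    obtain ⟨ej, hj⟩ := hj
    obtain ⟨ek, hk⟩ := hk
    have hdet := A.not_collinear hf hq hi hj hk hij hik hjk
    have ha : a = 0 := (mul_eq_zero.1 (show a * _ = 0 by
      linear_combination (X k - X i) * (ej - ei) - (X j - X i) * (ek - ei))).resolve_right hdet
    subst ha
    have hX : X j - X i ≠ 0 :=
      sub_ne_zero.2 fun h => hij (A.injOn _ _ hi.1 hi.2 hj.1 hj.2 h.symm)
    have hb : b = 0 := (mul_eq_zero.1 (show b * _ = 0 by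
      linear_combination ej - ei)).resolve_right hX
    subst hb
    have hd : d = 0 := by linear_combination ei
    simp [hd] at h0
  have hcover : ∀ i ∈ Z, i ∈ G ∨ i = P ∨ i = Q := by
    intro i hi
    rw [hG, Finset.mem_filter]
    tauto
  by_cases hP : P ∈ Z
  · by_cases hQ : Q ∈ Z
    · rw [hmem, A.X_P, A.Y_P] at hP
      rw [hmem, A.X_Q, A.Y_Q] at hQ
      have hsub : Z ⊆ {P, Q} := by
        intro i hi
        rw [Finset.mem_insert, Finset.mem_singleton]
        by_contra hn
        rw [not_or] at hn
        rw [hmem, A.Y_eq i hn.1 hn.2] at hi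
        have ha : a = 0 := (mul_eq_zero.1 (show a * _ = 0 by
          linear_combination hi + (1 + X i) * hQ - X i * hP - d * two)).resolve_right
            (hline (X i))
        subst ha
        have hd : d = 0 := by linear_combination hQ
        subst hd
        have hb : b = 0 := by linear_combination hP
        simp [hb] at h0
      exact (Finset.card_le_card hsub).trans (Finset.card_le_two.trans (by norm_num))
    · have hsub : Z ⊆ insert P G := by
        intro i hi
        rcases hcover i hi with h | h | h
        · exact Finset.mem_insert_of_mem h
        · exact h ▸ Finset.mem_insert_self _ _
        · exact absurd (h ▸ hi) hQ
      exact (Finset.card_le_card hsub).trans ((Finset.card_insert_le _ _).trans (by omega))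
  · have hsub : Z ⊆ insert Q G := by
      intro i hi
      rcases hcover i hi with h | h | h
      · exact Finset.mem_insert_of_mem h
      · exact absurd (h ▸ hi) hP
      · exact h ▸ Finset.mem_insert_self _ _
    exact (Finset.card_le_card hsub).trans ((Finset.card_insert_le _ _).trans (by omega))

/-- For each point there is a line avoiding it that contains three other points. -/
lemma exists_trisecant (A : IsOvalArrangement f X Y P Q) (hf : IsOvalPoly f)
    (hq : 3 < Fintype.card K) (hline : ∀ x, f.eval x + x + 1 ≠ 0) (i : ι) :
    ∃ b d : K, ∃ j k l : ι, j ≠ i ∧ k ≠ i ∧ l ≠ i ∧ Y j ≠ Y k ∧ Y j ≠ Y l ∧ Y k ≠ Y l ∧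
      Y j + b * X j + d = 0 ∧ Y k + b * X k + d = 0 ∧ Y l + b * X l + d = 0 := by
  classical
  have two : (2 : K) = 0 := CharTwo.two_eq_zero
  obtain ⟨x, hx⟩ : ∃ x, x ∉ ({0, 1, X i} : Finset K) := by
    by_contra! h
    have h3 : ({0, 1, X i} : Finset K).card ≤ 3 := Finset.card_le_three
    rw [Finset.eq_univ_iff_forall.2 h, Finset.card_univ] at h3
    omega
  simp only [Finset.mem_insert, Finset.mem_singleton, not_or] at hx
  obtain ⟨hx0, hx1, hxi⟩ := hx
  have hinj := hf.eval_injective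
  obtain ⟨t, y, hyx, hy0, htx, hty⟩ := hf.exists_secant_zero_one (by omega) hx0 hx1
  obtain ⟨t', y', hyx', hy0', htx', hty'⟩ := hf.exists_secant_one_zero (by omega) hx0 hx1
  obtain ⟨j, hjP, hjQ, hj⟩ := A.exists_index x hx0
  have hji : j ≠ i := fun h => hxi (by rw [← h, hj])
  have hYj : Y j = f.eval x := by rw [A.Y_eq j hjP hjQ, hj]
  by_cases hfirst : i ≠ P ∧ y ≠ X i
  · obtain ⟨k, hkP, hkQ, hk⟩ := A.exists_index y hy0
    have hYk : Y k = f.eval y := by rw [A.Y_eq k hkP hkQ, hk]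
    refine ⟨t, t, P, j, k, hfirst.1.symm, hji, fun h => hfirst.2 (by rw [← h, hk]), ?_, ?_, ?_,
      ?_, ?_, ?_⟩
    · rw [A.Y_P, hYj]
      exact fun h => hx0 (hinj (h.symm.trans hf.2.1.symm))
    · rw [A.Y_P, hYk]
      exact fun h => hy0 (hinj (h.symm.trans hf.2.1.symm))
    · rw [hYj, hYk]
      exact fun h => hyx (hinj h).symm
    · rw [A.Y_P, A.X_P]
      linear_combination t * two
    · rw [hYj, hj, htx]
    · rw [hYk, hk, hty]
  · have hx1' : f.eval x ≠ 1 := fun h => hx1 (hinj (h.trans hf.2.2.1.symm))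
    have hy1' : f.eval y' ≠ 1 := by
      intro h
      have : t' * y' = 0 := by linear_combination hty' - h - two
      rcases mul_eq_zero.1 this with h' | h'
      · rw [h'] at htx'
        exact hx1' (by linear_combination htx' - two)
      · exact hy0' h'
    have hiQ : i ≠ Q := by
      rintro rfl
      exact hfirst ⟨A.P_ne_Q.symm, by rwa [A.X_Q]⟩
    obtain ⟨k, hkP, hkQ, hk⟩ := A.exists_index y' hy0'
    have hYk : Y k = f.eval y' := by rw [A.Y_eq k hkP hkQ, hk]
    have hki : k ≠ i := by
      rintro rfl
      have hyy : y = y' := by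
        by_contra h
        exact hfirst ⟨hkP, by rwa [hk]⟩
      subst hyy
      have htt : (t - t') * (y - x) = 0 := by
        linear_combination hty - htx - (hty' - htx')
      have ht' := sub_eq_zero.1 ((mul_eq_zero.1 htt).resolve_right (sub_ne_zero.2 hyx))
      have ht1 : t = 1 := by
        rw [← ht'] at htx'
        linear_combination htx - htx'
      apply hline x
      rw [ht1] at htx
      linear_combination htx
    refine ⟨t', 1, Q, j, k, hiQ.symm, hji, hki, ?_, ?_, ?_, ?_, ?_, ?_⟩
    · rw [A.Y_Q, hYj]
      exact hx1'.symm
    · rw [A.Y_Q, hYk]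
      exact hy1'.symm
    · rw [hYj, hYk]
      exact fun h => hyx' (hinj h).symm
    · rw [A.Y_Q, A.X_Q]
      linear_combination two
    · rw [hYj, hj, htx']
    · rw [hYk, hk, hty']

/-- For each point there are three other points that are not collinear. -/
lemma exists_triangle (A : IsOvalArrangement f X Y P Q) (hf : IsOvalPoly f)
    (hq : 4 < Fintype.card K) (i : ι) :
    ∃ j k l : ι, j ≠ i ∧ k ≠ i ∧ l ≠ i ∧
      (Y k - Y j) * (X l - X j) - (Y l - Y j) * (X k - X j) ≠ 0 := by
  classical
  obtain ⟨z, hz⟩ : ∃ z : Finset K, z.card = 3 ∧ z ⊆ Finset.univ \ {0, X i} := by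
    have h2 : ({0, X i} : Finset K).card ≤ 2 := Finset.card_le_two
    have h3 : 3 ≤ (Finset.univ \ {0, X i} : Finset K).card := by
      have := Finset.le_card_sdiff ({0, X i} : Finset K) Finset.univ
      rw [Finset.card_univ] at this
      omega
    obtain ⟨z, hz, hc⟩ := Finset.exists_subset_card_eq h3
    exact ⟨z, hc, hz⟩
  obtain ⟨x, y, w, hxy, hxw, hyw, rfl⟩ := Finset.card_eq_three.1 hz.1
  have hne : ∀ t ∈ ({x, y, w} : Finset K), ∃ j, j ≠ P ∧ j ≠ Q ∧ j ≠ i ∧ X j = t := by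
    intro t ht
    have h := hz.2 ht
    simp only [Finset.mem_sdiff, Finset.mem_univ, Finset.mem_insert, Finset.mem_singleton,
      not_or, true_and] at h
    obtain ⟨j, hP, hQ, hj⟩ := A.exists_index t h.1
    exact ⟨j, hP, hQ, fun e => h.2 (by rw [← e, hj]), hj⟩
  obtain ⟨j, hjP, hjQ, hji, rfl⟩ := hne x (by simp)
  obtain ⟨k, hkP, hkQ, hki, rfl⟩ := hne y (by simp)
  obtain ⟨l, hlP, hlQ, hli, rfl⟩ := hne w (by simp)
  exact ⟨j, k, l, hji, hki, hli, A.not_collinear hf (by omega) ⟨hjP, hjQ⟩ ⟨hkP, hkQ⟩ ⟨hlP, hlQ⟩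
    (fun h => hxy (congrArg X h)) (fun h => hxw (congrArg X h)) (fun h => hyw (congrArg X h))⟩

end IsOvalArrangement

end OvalArrangements

section OvalCodes

variable {K : Type*} [Field K] [Fintype K] {f : Polynomial K} {C : Submodule K (ι → K)}
  {X Y : ι → K} {P Q : ι}

/-- In a code spanned by `Y`, `X` and the all-one word, a non-collinear triple of coordinates `jkl`
yields a dual word of weight at most four through any further coordinate `i`. -/
lemma exists_dual_word_of_triangle (hC : ∀ c, c ∈ C ↔ ∃ a b d, ∀ i, c i = a * Y i + b * X i + d)
    {i j k l : ι} (hj : j ≠ i) (hk : k ≠ i) (hl : l ≠ i)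
    (h : (Y k - Y j) * (X l - X j) - (Y l - Y j) * (X k - X j) ≠ 0) :
    ∃ w ∈ dualCode C, w i ≠ 0 ∧ wt w ≤ 4 := by
  classical
  refine ⟨Pi.single i ((Y k - Y j) * (X l - X j) - (Y l - Y j) * (X k - X j))
    + Pi.single j ((Y l - Y i) * (X k - X i) - (Y k - Y i) * (X l - X i))
    + Pi.single k ((Y j - Y i) * (X l - X i) - (Y l - Y i) * (X j - X i))
    + Pi.single l ((Y k - Y i) * (X j - X i) - (Y j - Y i) * (X k - X i)), ?_, ?_, ?_⟩
  · intro c hc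
    obtain ⟨a, b, d, hc⟩ := (hC c).1 hc
    simp only [Pi.add_apply, add_mul, Finset.sum_add_distrib,
      Pi.single_apply, ite_mul, zero_mul, Finset.sum_ite_eq',
      Finset.mem_univ, if_true, hc]
    ring
  · simpa [hj.symm, hk.symm, hl.symm] using h
  · refine (wt_le_card {i, j, k, l} fun t ht => ?_).trans Finset.card_le_four
    by_contra hn
    simp only [Finset.mem_insert, Finset.mem_singleton, not_or] at hn
    exact ht (by simp [hn])

/-- Three collinear coordinates yield a nonzero dual word of weight at most three. -/
lemma exists_dual_word_of_collinear (hC : ∀ c, c ∈ C ↔ ∃ a b d, ∀ i, c i = a * Y i + b * X i + d)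
    {j k l : ι} (hjk : Y j ≠ Y k) (hjl : Y j ≠ Y l) (hkl : Y k ≠ Y l)
    (h : (Y k - Y j) * (X l - X j) - (Y l - Y j) * (X k - X j) = 0) :
    ∃ w ∈ dualCode C, w ≠ 0 ∧ wt w ≤ 3 := by
  classical
  refine ⟨Pi.single j (Y k - Y l) + Pi.single k (Y l - Y j) + Pi.single l (Y j - Y k), ?_, ?_, ?_⟩
  · intro c hc
    obtain ⟨a, b, d, hc⟩ := (hC c).1 hc
    simp only [Pi.add_apply, add_mul, Finset.sum_add_distrib,
      Pi.single_apply, ite_mul, zero_mul, Finset.sum_ite_eq',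
      Finset.mem_univ, if_true, hc]
    linear_combination (-b) * h
  · intro h0
    have := congrFun h0 j
    have e1 : j ≠ k := fun e => hjk (by rw [e])
    have e2 : j ≠ l := fun e => hjl (by rw [e])
    rw [Pi.add_apply, Pi.add_apply, Pi.single_eq_same, Pi.single_eq_of_ne e1,
      Pi.single_eq_of_ne e2, add_zero, add_zero, Pi.zero_apply] at this
    exact hkl (sub_eq_zero.1 this)
  · refine (wt_le_card {j, k, l} fun t ht => ?_).trans Finset.card_le_three
    by_contra hn
    simp only [Finset.mem_insert, Finset.mem_singleton, not_or] at hn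
    exact ht (by simp [hn])

namespace IsOvalArrangement

variable [CharP K 2]

lemma card_le_wt_add_three (A : IsOvalArrangement f X Y P Q) (hf : IsOvalPoly f)
    (hq : 2 < Fintype.card K) (hline : ∀ x, f.eval x + x + 1 ≠ 0)
    (hC : ∀ c, c ∈ C ↔ ∃ a b d, ∀ i, c i = a * Y i + b * X i + d) {c : ι → K} (hc : c ∈ C)
    (h0 : c ≠ 0) : Fintype.card ι ≤ wt c + 3 := by
  classical
  obtain ⟨a, b, d, hc⟩ := (hC c).1 hc
  rw [← wt_add_card_zeros c]
  simp only [hc]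
  refine Nat.add_le_add_left (A.card_line_le hf hq hline ?_) _
  by_contra! hn
  exact h0 (funext fun i => by rw [hc, hn.1, hn.2.1, hn.2.2]; simp)

lemma exists_word_through (A : IsOvalArrangement f X Y P Q) (hf : IsOvalPoly f)
    (hq : 3 < Fintype.card K) (hline : ∀ x, f.eval x + x + 1 ≠ 0)
    (hC : ∀ c, c ∈ C ↔ ∃ a b d, ∀ i, c i = a * Y i + b * X i + d) (i : ι) :
    ∃ c ∈ C, c i ≠ 0 ∧ wt c + 3 = Fintype.card ι := by
  classical
  obtain ⟨b, d, j, k, l, hji, hki, hli, hjk, hjl, hkl, hj, hk, hl⟩ :=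
    A.exists_trisecant hf hq hline i
  have hle : (Finset.univ.filter fun t => 1 * Y t + b * X t + d = 0).card ≤ 3 :=
    A.card_line_le hf (by omega) hline (Or.inl one_ne_zero)
  have h3 : ({j, k, l} : Finset ι).card = 3 := Finset.card_eq_three.2
    ⟨j, k, l, fun e => hjk (by rw [e]), fun e => hjl (by rw [e]), fun e => hkl (by rw [e]), rfl⟩
  have hsub : ({j, k, l} : Finset ι) ⊆
      Finset.univ.filter fun t => 1 * Y t + b * X t + d = 0 := by
    intro t ht
    simp only [Finset.mem_insert, Finset.mem_singleton] at ht
    rw [Finset.mem_filter, one_mul]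
    rcases ht with rfl | rfl | rfl
    exacts [⟨Finset.mem_univ _, hj⟩, ⟨Finset.mem_univ _, hk⟩, ⟨Finset.mem_univ _, hl⟩]
  have heq := Finset.eq_of_subset_of_card_le hsub (by rw [h3]; exact hle)
  refine ⟨fun t => 1 * Y t + b * X t + d, (hC _).2 ⟨1, b, d, fun _ => rfl⟩, ?_, ?_⟩
  · intro hi
    have : i ∈ ({j, k, l} : Finset ι) := by
      rw [heq]
      simpa using hi
    simp only [Finset.mem_insert, Finset.mem_singleton] at this
    rcases this with h | h | h
    exacts [hji h.symm, hki h.symm, hli h.symm]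
  · rw [← wt_add_card_zeros fun t => 1 * Y t + b * X t + d, ← heq, h3]

lemma three_lt_wt_dual (A : IsOvalArrangement f X Y P Q) (hf : IsOvalPoly f)
    (hq : 2 < Fintype.card K) (hι : 3 ≤ Fintype.card ι)
    (hC : ∀ c, c ∈ C ↔ ∃ a b d, ∀ i, c i = a * Y i + b * X i + d) {i : ι}
    (hi : i ≠ P ∧ i ≠ Q) (hi1 : X i = 1) {w : ι → K} (hw : w ∈ dualCode C) (hwi : w i ≠ 0) :
    3 < wt w := by
  classical
  refine lt_wt_of_separates (r := 2) hw hwi hι fun R hR hiR => ?_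
  obtain ⟨j, k, hjk, rfl⟩ := Finset.card_eq_two.1 hR
  simp only [Finset.mem_insert, Finset.mem_singleton, not_or] at hiR
  have hdet := A.not_collinear_of_X_eq_one hf hq hi hi1 hiR.1 hiR.2 hjk
  refine ⟨fun t => (X j - X k) * Y t + (Y k - Y j) * X t + (Y j * X k - Y k * X j),
    (hC _).2 ⟨_, _, _, fun _ => rfl⟩, fun h => hdet (by linear_combination h), ?_⟩
  intro t ht
  simp only [Finset.mem_insert, Finset.mem_singleton] at ht
  rcases ht with rfl | rfl <;> ring

lemma two_lt_wt_dual (A : IsOvalArrangement f X Y P Q) (hf : IsOvalPoly f)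
    (hι : 2 ≤ Fintype.card ι)
    (hC : ∀ c, c ∈ C ↔ ∃ a b d, ∀ i, c i = a * Y i + b * X i + d)
    {w : ι → K} (hw : w ∈ dualCode C) (h0 : w ≠ 0) : 2 < wt w := by
  classical
  obtain ⟨i, hwi⟩ := Function.ne_iff.1 h0
  refine lt_wt_of_separates (r := 1) hw hwi hι fun R hR hiR => ?_
  obtain ⟨j, rfl⟩ := Finset.card_eq_one.1 hR
  rw [Finset.mem_singleton] at hiR
  rcases A.X_ne_or_Y_ne hf hiR with h | h
  · refine ⟨fun t => 0 * Y t + 1 * X t + -X j, (hC _).2 ⟨_, _, _, fun _ => rfl⟩,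
      fun e => h (by linear_combination e), ?_⟩
    simp
  · refine ⟨fun t => 1 * Y t + 0 * X t + -Y j, (hC _).2 ⟨_, _, _, fun _ => rfl⟩,
      fun e => h (by linear_combination e), ?_⟩
    simp

lemma locality_and_minDist (A : IsOvalArrangement f X Y P Q) (hf : IsOvalPoly f)
    (hq : 4 < Fintype.card K) (hι : Fintype.card ι = Fintype.card K + 1)
    (hline : ∀ x, f.eval x + x + 1 ≠ 0)
    (hC : ∀ c, c ∈ C ↔ ∃ a b d, ∀ i, c i = a * Y i + b * X i + d) :
    IsLeast {r : ℕ | HasLinearLocality (dualCode C) r} (Fintype.card K - 3) ∧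
    minDist C = Fintype.card K - 2 ∧
    IsLeast {r : ℕ | HasLinearLocality C r} 3 ∧
    minDist (dualCode C) = 3 := by
  obtain ⟨i, hiP, hiQ, hi1⟩ := A.exists_index 1 one_ne_zero
  have hthrough := A.exists_word_through hf (by omega) hline hC
  have hwt : ∀ c ∈ C, c ≠ 0 → Fintype.card K - 2 ≤ wt c := by
    intro c hc h0
    have := A.card_le_wt_add_three hf (by omega) hline hC hc h0
    omega
  refine ⟨⟨?_, ?_⟩, ?_, ⟨?_, ?_⟩, ?_⟩
  · refine hasLinearLocality_iff.2 fun j => ?_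
    obtain ⟨c, hc, hcj, hcw⟩ := hthrough j
    exact ⟨c, by rwa [dualCode_dualCode], hcj, by omega⟩
  · intro r hr
    obtain ⟨c, hc, hci, hcw⟩ := hasLinearLocality_iff.1 hr i
    rw [dualCode_dualCode] at hc
    have := hwt c hc fun h => hci (by rw [h]; rfl)
    omega
  · obtain ⟨c, hc, hci, hcw⟩ := hthrough i
    exact minDist_eq ⟨c, hc, fun h => hci (by rw [h]; rfl), by omega⟩ hwt
  · refine hasLinearLocality_iff.2 fun j => ?_
    obtain ⟨k, l, t, hk, hl, ht, hdet⟩ := A.exists_triangle hf hq j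
    exact exists_dual_word_of_triangle hC hk hl ht hdet
  · intro r hr
    obtain ⟨w, hw, hwi, hww⟩ := hasLinearLocality_iff.1 hr i
    have := A.three_lt_wt_dual hf (by omega) (by omega) hC ⟨hiP, hiQ⟩ hi1 hw hwi
    omega
  · have hlow : ∀ w ∈ dualCode C, w ≠ 0 → 3 ≤ wt w := fun w hw h0 =>
      A.two_lt_wt_dual hf (by omega) hC hw h0
    obtain ⟨b, d, j, k, l, -, -, -, hjk, hjl, hkl, hj, hk, hl⟩ :=
      A.exists_trisecant hf (by omega) hline i
    obtain ⟨w, hw, h0, hle⟩ := exists_dual_word_of_collinear hC hjk hjl hkl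
      (by linear_combination (X l - X j) * (hk - hj) - (X k - X j) * (hl - hj))
    exact minDist_eq ⟨w, hw, h0, le_antisymm hle (hlow w hw h0)⟩ hlow

end IsOvalArrangement

/-- The columns of the generator matrix of `ovalCode f α` form an oval arrangement. -/
lemma isOvalArrangement_ovalCode (hq : 2 < Fintype.card K) {α : K}
    (hα : ∀ x : K, x ≠ 0 → ∃ k : ℕ, α ^ k = x) :
    IsOvalArrangement f
      (fun i : Fin (Fintype.card K + 1) => if (i : ℕ) < Fintype.card K - 1 then α ^ (i : ℕ)
        else if (i : ℕ) = Fintype.card K - 1 then 1 else 0)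
      (fun i : Fin (Fintype.card K + 1) => if (i : ℕ) < Fintype.card K - 1
        then f.eval (α ^ (i : ℕ)) else if (i : ℕ) = Fintype.card K - 1 then 0 else 1)
      ⟨Fintype.card K - 1, by omega⟩ ⟨Fintype.card K, by omega⟩ := by
  classical
  have hα0 : α ≠ 0 := by
    rintro rfl
    obtain ⟨x, hx⟩ : ∃ x, x ∉ ({0, 1} : Finset K) := by
      by_contra! h
      have h2 : ({0, 1} : Finset K).card ≤ 2 := Finset.card_le_two
      rw [Finset.eq_univ_iff_forall.2 h, Finset.card_univ] at h2
      omega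
    simp only [Finset.mem_insert, Finset.mem_singleton, not_or] at hx
    obtain ⟨k, hk⟩ := hα x hx.1
    rcases k with _ | k
    · exact hx.2 (by rw [← hk, pow_zero])
    · exact hx.1 (by rw [← hk, zero_pow (Nat.succ_ne_zero k)])
  have hone : α ^ (Fintype.card K - 1) = 1 := FiniteField.pow_card_sub_one_eq_one α hα0
  have hpos : 0 < Fintype.card K - 1 := by omega
  have hsurj : ∀ x : K, x ≠ 0 → ∃ k < Fintype.card K - 1, α ^ k = x := by
    intro x hx
    obtain ⟨k, rfl⟩ := hα x hx
    exact ⟨k % (Fintype.card K - 1), Nat.mod_lt _ hpos, (pow_eq_pow_mod k hone).symm⟩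
  have hinj : Set.InjOn (fun k => α ^ k) (Finset.range (Fintype.card K - 1)) := by
    apply Finset.injOn_of_surjOn_of_card_le (t := Finset.univ.erase (0 : K))
    · intro k _
      simp [hα0]
    · intro x hx
      obtain ⟨k, hk, rfl⟩ := hsurj x (by simpa using hx)
      exact ⟨k, by simpa using hk, rfl⟩
    · rw [Finset.card_range, Finset.card_erase_of_mem (Finset.mem_univ _), Finset.card_univ]
  have hlt : ∀ i : Fin (Fintype.card K + 1), i ≠ ⟨Fintype.card K - 1, by omega⟩ →
      i ≠ ⟨Fintype.card K, by omega⟩ → (i : ℕ) < Fintype.card K - 1 := by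
    intro i h1 h2
    have h1' : (i : ℕ) ≠ Fintype.card K - 1 := fun e => h1 (Fin.ext e)
    have h2' : (i : ℕ) ≠ Fintype.card K := fun e => h2 (Fin.ext e)
    have := i.2
    omega
  refine ⟨by simp, by simp, ?_, ?_, ?_, ?_, ?_, ?_⟩
  · simp only
    rw [if_neg (by omega), if_neg (by omega)]
  · simp only
    rw [if_neg (by omega), if_neg (by omega)]
  · intro i h1 h2
    rw [if_pos (hlt i h1 h2)]
    exact pow_ne_zero _ hα0
  · intro i h1 h2
    simp only [if_pos (hlt i h1 h2)]
  · intro x hx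
    obtain ⟨k, hk, rfl⟩ := hsurj x hx
    refine ⟨⟨k, by omega⟩, ?_, ?_, if_pos hk⟩
    · rw [Ne, Fin.mk.injEq]
      omega
    · rw [Ne, Fin.mk.injEq]
      omega
  · intro i j h1 h2 h3 h4 h
    have hi := hlt i h1 h2
    have hj := hlt j h3 h4
    simp only [if_pos hi, if_pos hj] at h
    exact Fin.ext (hinj (by simpa using hi) (by simpa using hj) h)

end OvalCodes

/-- Let `m ≥ 3` be odd, `q = 2^m`, `f` an oval polynomial over `GF(q)` with
coefficients in `GF(2)`, and `α` a generator of `GF(q)*`. Then `C_f⊥` has minimum linear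
locality `q - 3 = d(C_f) - 1`, while `C_f` itself has minimum linear locality `3 = d(C_f⊥)`;
in particular the minimum linear locality of `C_f` exceeds `d(C_f⊥) - 1`. -/
theorem statement19 {F : Type*} [Field F] [Fintype F] (m : ℕ) (hm : 3 ≤ m) (hodd : Odd m)
    (hF : Fintype.card F = 2 ^ m) (f : Polynomial F) (hf : IsOvalPoly f)
    (hcoef : ∀ k : ℕ, f.coeff k = 0 ∨ f.coeff k = 1)
    (α : F) (hα : ∀ x : F, x ≠ 0 → ∃ k : ℕ, α ^ k = x) :
    IsLeast {r : ℕ | HasLinearLocality (dualCode (ovalCode f α)) r} (Fintype.card F - 3) ∧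
    minDist (ovalCode f α) = Fintype.card F - 2 ∧
    IsLeast {r : ℕ | HasLinearLocality (ovalCode f α) r} 3 ∧
    minDist (dualCode (ovalCode f α)) = 3 := by
  have hq : 8 ≤ Fintype.card F := by
    rw [hF]
    calc 8 = 2 ^ 3 := by norm_num
      _ ≤ 2 ^ m := Nat.pow_le_pow_right (by norm_num) hm
  have two : (2 : F) = 0 := by
    have h := Nat.cast_card_eq_zero F
    rw [hF, Nat.cast_pow, Nat.cast_ofNat] at h
    exact eq_zero_of_pow_eq_zero h
  have : CharP F 2 := CharTwo.of_one_ne_zero_of_two_eq_zero one_ne_zero two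
  refine (isOvalArrangement_ovalCode (by omega) hα).locality_and_minDist hf (by omega)
    (Fintype.card_fin _) (hf.eval_ne_add_one (by omega) hodd hF hcoef) fun c => ?_
  refine exists_congr fun a => exists_congr fun b => exists_congr fun d => forall_congr' fun i => ?_
  split_ifs <;> simp
end
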